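/- Every solution of the IVP has at most finitely many sign changes: for any solution u of the IVP with initial value α > 0, the set { r > 0 : u(r) = 0 } is finite. -/

import Mathlib

open Real Filter Set

/-- The nonlinearity `f(s) = -s + |s|^(p-1) s`. -/
noncomputable def f (p s : ℝ) : ℝ := -s + |s| ^ (p - 1) * s

/-- The derivative of the nonlinearity, `f'(s) = -1 + p |s|^(p-1)`. -/
noncomputable def fder (p s : ℝ) : ℝ := -1 + p * |s| ^ (p - 1)

/-- The primitive `F(s) = -s^2/2 + |s|^(p+1)/(p+1)`. -/
noncomputable def F (p s : ℝ) : ℝ := -s ^ 2 / 2 + |s| ^ (p + 1) / (p + 1)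

/-- `u : [0,∞) → ℝ` (modeled on `Set.Ici 0`) is a C² solution of the IVP
`u'' + ((n-1)/r) u' + f(u) = 0`, `u(0) = α`, `u'(0) = 0`; the data `u'`, `u''`
are its first and second derivatives on `[0,∞)`. -/
structure IsSolution (n : ℕ) (p α : ℝ) (u u' u'' : ℝ → ℝ) : Prop where
  init : u 0 = α
  initDeriv : u' 0 = 0
  hasDeriv1 : ∀ r ∈ Set.Ici (0:ℝ), HasDerivWithinAt u (u' r) (Set.Ici 0) r
  hasDeriv2 : ∀ r ∈ Set.Ici (0:ℝ), HasDerivWithinAt u' (u'' r) (Set.Ici 0) r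
  cont2 : ContinuousOn u'' (Set.Ici 0)
  ode : ∀ r : ℝ, 0 < r → u'' r + ((n : ℝ) - 1) / r * u' r + f p (u r) = 0

/-- The variation `v` associated with a solution `u`: the C² solution of the linearized
equation `v'' + ((n-1)/r) v' + f'(u) v = 0`, `v(0) = 1`, `v'(0) = 0`. -/
structure IsVariation (n : ℕ) (p : ℝ) (u v v' v'' : ℝ → ℝ) : Prop where
  init : v 0 = 1
  initDeriv : v' 0 = 0
  hasDeriv1 : ∀ r ∈ Set.Ici (0:ℝ), HasDerivWithinAt v (v' r) (Set.Ici 0) r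
  hasDeriv2 : ∀ r ∈ Set.Ici (0:ℝ), HasDerivWithinAt v' (v'' r) (Set.Ici 0) r
  cont2 : ContinuousOn v'' (Set.Ici 0)
  ode : ∀ r : ℝ, 0 < r → v'' r + ((n : ℝ) - 1) / r * v' r + fder p (u r) * v r = 0

/-- `u` is decaying: `u(r) → 0` and `u'(r) → 0` as `r → ∞`. -/
def Decaying (u u' : ℝ → ℝ) : Prop :=
  Filter.Tendsto u Filter.atTop (nhds 0) ∧ Filter.Tendsto u' Filter.atTop (nhds 0)

/-- `u` changes sign on `(0,∞)`. -/
def ChangesSign (u : ℝ → ℝ) : Prop :=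
  (∃ r : ℝ, 0 < r ∧ u r < 0) ∧ (∃ r : ℝ, 0 < r ∧ 0 < u r)

/-- `z 0 < z 1 < ⋯ < z (k-1)` are exactly the zeros of `u` in `(0,∞)`. -/
def ExactZeros (u : ℝ → ℝ) (k : ℕ) (z : Fin k → ℝ) : Prop :=
  StrictMono z ∧ (∀ i, 0 < z i ∧ u (z i) = 0) ∧
    ∀ r : ℝ, 0 < r → u r = 0 → ∃ i, r = z i

/-- The energy `u'(r)^2 / 2 + F(u(r))`. -/
noncomputable def energy (p : ℝ) (u u' : ℝ → ℝ) (r : ℝ) : ℝ := u' r ^ 2 / 2 + F p (u r)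

/-- The Pohozaev-type functional `r E(r) + a u(r) u'(r)`. -/
noncomputable def pohozaev (p a : ℝ) (u u' : ℝ → ℝ) (r : ℝ) : ℝ :=
  r * energy p u u' r + a * (u r * u' r)

theorem abs_rpow_add_one {p : ℝ} (hp : 1 < p) (s : ℝ) :
    |s| ^ (p + 1) = |s| ^ (p - 1) * s ^ 2 := by
  rw [show p + 1 = (p - 1) + (2 : ℕ) by push_cast; ring,
    Real.rpow_add_natCast' (abs_nonneg s) (by push_cast; linarith), sq_abs]

theorem hasDerivAt_F {p : ℝ} (hp : 1 < p) (s : ℝ) : HasDerivAt (F p) (f p s) s := by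
  have h1 := (hasDerivAt_abs_rpow s (show 1 < p + 1 by linarith)).div_const (p + 1)
  have h2 := ((hasDerivAt_pow 2 s).neg.div_const 2).add h1
  refine h2.congr_deriv ?_
  have : p + 1 ≠ 0 := by linarith
  rw [show p + 1 - 2 = p - 1 by ring]
  unfold f
  field_simp
  push_cast
  ring

theorem F_zero {p : ℝ} (hp : 1 < p) : F p 0 = 0 := by
  simp [F, Real.zero_rpow (show p + 1 ≠ 0 by linarith)]

theorem one_le_sq_of_F_nonneg {p s : ℝ} (hp : 1 < p) (hs : s ≠ 0) (hF : 0 ≤ F p s) :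
    1 ≤ s ^ 2 := by
  by_contra! h
  have hs1 : |s| ≤ 1 := by
    rw [← sq_abs] at h
    nlinarith [abs_nonneg s]
  have hw : |s| ^ (p - 1) ≤ 1 := Real.rpow_le_one (abs_nonneg s) hs1 (by linarith)
  have hs2 : 0 < s ^ 2 := by positivity
  rw [F, abs_rpow_add_one hp] at hF
  have hle : |s| ^ (p - 1) * s ^ 2 / (p + 1) < s ^ 2 / 2 := by
    rw [div_lt_div_iff₀ (by linarith) two_pos]
    nlinarith
  linarith

namespace IsSolution

variable {n : ℕ} {p α : ℝ} {u u' u'' : ℝ → ℝ}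

theorem hasDerivAt (hu : IsSolution n p α u u' u'') {r : ℝ} (hr : 0 < r) :
    HasDerivAt u (u' r) r :=
  (hu.hasDeriv1 r hr.le).hasDerivAt (Ici_mem_nhds hr)

theorem hasDerivAt' (hu : IsSolution n p α u u' u'') {r : ℝ} (hr : 0 < r) :
    HasDerivAt u' (u'' r) r :=
  (hu.hasDeriv2 r hr.le).hasDerivAt (Ici_mem_nhds hr)

theorem continuousOn (hu : IsSolution n p α u u' u'') : ContinuousOn u (Ici 0) :=
  fun r hr => (hu.hasDeriv1 r hr).continuousWithinAt

theorem energy_hasDerivAt (hu : IsSolution n p α u u' u'') (hp : 1 < p) {r : ℝ} (hr : 0 < r) :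
    HasDerivAt (energy p u u') (-(((n : ℝ) - 1) / r * u' r ^ 2)) r := by
  have h := (((hu.hasDerivAt' hr).pow 2).div_const 2).add
    ((hasDerivAt_F hp (u r)).comp r (hu.hasDerivAt hr))
  refine h.congr_deriv ?_
  have hode := hu.ode r hr
  push_cast
  linear_combination u' r * hode

theorem energy_antitoneOn (hu : IsSolution n p α u u' u'') (hn : 1 ≤ n) (hp : 1 < p) :
    AntitoneOn (energy p u u') (Ioi 0) := by
  have hn' : (1 : ℝ) ≤ n := by exact_mod_cast hn
  refine antitoneOn_of_hasDerivWithinAt_nonpos (convex_Ioi 0)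
    (fun r hr => (hu.energy_hasDerivAt hp hr).continuousAt.continuousWithinAt)
    (fun r hr => (hu.energy_hasDerivAt hp (interior_subset hr)).hasDerivWithinAt) ?_
  intro r hr
  have hr' : 0 < r := interior_subset hr
  have : 0 ≤ ((n : ℝ) - 1) / r * u' r ^ 2 :=
    mul_nonneg (div_nonneg (by linarith) hr'.le) (sq_nonneg _)
  linarith

theorem energy_eq_of_zero (hp : 1 < p) {z : ℝ} (hz : u z = 0) :
    energy p u u' z = u' z ^ 2 / 2 := by
  rw [energy, hz, F_zero hp, add_zero]

/-- A nontrivial solution has only simple zeros. -/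
theorem deriv_ne_zero_of_zero (hu : IsSolution n p α u u' u'') (hn : 1 ≤ n) (hp : 1 < p)
    (hα : α ≠ 0) {z : ℝ} (hz : 0 < z) (huz : u z = 0) : u' z ≠ 0 := by
  intro hz'
  have hn' : (1 : ℝ) ≤ n := by exact_mod_cast hn
  have hzero : ∀ ε, 0 < ε → ε ≤ z → u ε = 0 := by
    intro ε hε hεz
    obtain ⟨B, hB⟩ := isCompact_Icc.exists_bound_of_continuousOn
      (hu.continuousOn.mono (fun r (hr : r ∈ Icc ε z) => hε.le.trans hr.1))
    set M := |B| ^ (p - 1)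
    -- the squared norm of the Cauchy data, weighted by `exp (K r)`, is monotone on `[ε, z]`
    set K := 2 + M + 2 * (((n : ℝ) - 1) / ε) with hK
    have hd : ∀ r, 0 < r → HasDerivAt (fun r => Real.exp (K * r) * (u r ^ 2 + u' r ^ 2))
        (Real.exp (K * r) * (K * (u r ^ 2 + u' r ^ 2) + 2 * (u r * u' r) +
          2 * (u' r * u'' r))) r := by
      intro r hr
      refine ((((hasDerivAt_id r).const_mul K).exp).mul
        (((hu.hasDerivAt hr).pow 2).add ((hu.hasDerivAt' hr).pow 2))).congr_deriv ?_
      norm_num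
      ring
    have hpos : ∀ r ∈ Icc ε z, 0 < r := fun r hr => hε.trans_le hr.1
    have hmono : MonotoneOn (fun r => Real.exp (K * r) * (u r ^ 2 + u' r ^ 2)) (Icc ε z) := by
      refine monotoneOn_of_hasDerivWithinAt_nonneg (convex_Icc ε z)
        (fun r hr => (hd r (hpos r hr)).continuousAt.continuousWithinAt)
        (fun r hr => (hd r (hpos r (interior_subset hr))).hasDerivWithinAt) ?_
      intro r hr
      have hr' : r ∈ Icc ε z := interior_subset hr
      refine mul_nonneg (Real.exp_pos _).le ?_
      have hw : |u r| ^ (p - 1) ≤ M :=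
        Real.rpow_le_rpow (abs_nonneg _) ((hB r hr').trans (le_abs_self B)) (by linarith)
      have hw0 : 0 ≤ |u r| ^ (p - 1) := by positivity
      have hode : u'' r = -(((n : ℝ) - 1) / r * u' r) - f p (u r) := by
        linarith [hu.ode r (hpos r hr')]
      have hq : ((n : ℝ) - 1) / r ≤ ((n : ℝ) - 1) / ε :=
        div_le_div_of_nonneg_left (by linarith) hε hr'.1
      have hq0 : 0 ≤ ((n : ℝ) - 1) / ε := div_nonneg (by linarith) hε.le
      rw [hode, hK, f]
      generalize |u r| ^ (p - 1) = w at *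
      generalize ((n : ℝ) - 1) / r = q at *
      generalize ((n : ℝ) - 1) / ε = q' at *
      nlinarith [mul_nonneg (sub_nonneg.2 hq) (sq_nonneg (u' r)), mul_nonneg hq0 (sq_nonneg (u r)),
        mul_nonneg (sub_nonneg.2 hw) (add_nonneg (sq_nonneg (u r)) (sq_nonneg (u' r))),
        mul_nonneg hw0 (sq_nonneg (u r - u' r)), sq_nonneg (u r + u' r)]
    have hle := hmono (left_mem_Icc.2 hεz) (right_mem_Icc.2 hεz) hεz
    simp only [huz, hz', ne_eq, OfNat.ofNat_ne_zero, not_false_eq_true, zero_pow, add_zero,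
      mul_zero] at hle
    have hN : u ε ^ 2 + u' ε ^ 2 ≤ 0 := nonpos_of_mul_nonpos_right hle (Real.exp_pos _)
    exact pow_eq_zero_iff two_ne_zero |>.1 (by nlinarith [sq_nonneg (u ε), sq_nonneg (u' ε)])
  have hlim : Tendsto u (nhdsWithin 0 (Ioi 0)) (nhds (u 0)) :=
    ((hu.continuousOn 0 self_mem_Ici).mono Ioi_subset_Ici_self)
  have hev : u =ᶠ[nhdsWithin 0 (Ioi 0)] fun _ => 0 := by
    filter_upwards [Ioc_mem_nhdsGT hz] with r hr using hzero r hr.1 hr.2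
  have := tendsto_nhds_unique hlim (tendsto_const_nhds.congr' hev.symm)
  exact hα (hu.init ▸ this)

/-- Between two zeros there is a critical point where `u ^ 2 ≥ 1`. -/
theorem exists_critical_point (hu : IsSolution n p α u u' u'') (hn : 1 ≤ n) (hp : 1 < p)
    (hα : α ≠ 0) {z y : ℝ} (hz : 0 < z) (hzy : z < y) (huz : u z = 0) (huy : u y = 0) :
    ∃ c ∈ Ioo z y, u' c = 0 ∧ 1 ≤ u c ^ 2 := by
  have hpos : ∀ r ∈ Icc z y, 0 < r := fun r hr => hz.trans_le hr.1
  obtain ⟨c, hc, hmax⟩ := isCompact_Icc.exists_isMaxOn (nonempty_Icc.2 hzy.le)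
    ((hu.continuousOn.mono fun r hr => (hpos r hr).le).pow 2)
  have hne : u c ≠ 0 := by
    have h1 := (hu.hasDerivAt hz).eventually_ne (c := 0)
      (hu.deriv_ne_zero_of_zero hn hp hα hz huz)
    have h2 : ∀ᶠ r in nhdsWithin z (Ioi z), u r ≠ 0 :=
      nhdsWithin_mono z (fun r (hr : z < r) => hr.ne') h1
    obtain ⟨r, hr, hrz⟩ := (h2.and (Ioc_mem_nhdsGT hzy)).exists
    have h3 : u r ^ 2 ≤ u c ^ 2 := hmax (Ioc_subset_Icc_self hrz)
    intro h0
    rw [h0] at h3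
    exact hr (pow_eq_zero_iff two_ne_zero |>.1 (le_antisymm (by simpa using h3) (sq_nonneg _)))
  have hcz : c ≠ z := fun h => hne (h ▸ huz)
  have hcy : c ≠ y := fun h => hne (h ▸ huy)
  have hc' : c ∈ Ioo z y := ⟨lt_of_le_of_ne hc.1 hcz.symm, lt_of_le_of_ne hc.2 hcy⟩
  have hloc : IsLocalMax (fun r => u r ^ 2) c :=
    hmax.isLocalMax (Icc_mem_nhds hc'.1 hc'.2)
  have hd := hloc.hasDerivAt_eq_zero ((hu.hasDerivAt (hpos c hc)).pow 2)
  have hu'c : u' c = 0 := by simpa [hne] using hd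
  refine ⟨c, hc', hu'c, one_le_sq_of_F_nonneg hp hne ?_⟩
  have hE := hu.energy_antitoneOn hn hp (hpos c hc) (hz.trans hzy) hc.2
  rw [energy_eq_of_zero hp huy, energy, hu'c] at hE
  nlinarith [sq_nonneg (u' y)]

theorem pohozaev_hasDerivAt (hu : IsSolution n p α u u' u'') (hp : 1 < p) (a : ℝ) {r : ℝ}
    (hr : 0 < r) :
    HasDerivAt (pohozaev p a u u')
      ((a + 3 / 2 - n) * u' r ^ 2 - (1 / 2 - a) * u r ^ 2
        - (a - 1 / (p + 1)) * |u r| ^ (p + 1) - a * ((n : ℝ) - 1) / r * (u r * u' r)) r := by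
  have h := ((hasDerivAt_id r).mul (hu.energy_hasDerivAt hp hr)).add
    (((hu.hasDerivAt hr).mul (hu.hasDerivAt' hr)).const_mul a)
  refine h.congr_deriv ?_
  have hode : u'' r = -(((n : ℝ) - 1) / r * u' r) - f p (u r) := by linarith [hu.ode r hr]
  have hp' : p + 1 ≠ 0 := by linarith
  rw [hode, energy, F, f, abs_rpow_add_one hp, id]
  field_simp
  ring

/-- For `1 / (p + 1) < a < 1 / 2` the functional dissipates at least `δ (u ^ 2 + u' ^ 2)` for large
`r`, which leaves room to absorb `k u ^ 2`. -/
theorem pohozaev_add_sq_antitoneOn (hu : IsSolution n p α u u' u'') (hn : 2 ≤ n) (hp : 1 < p)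
    {a : ℝ} (ha : 1 / (p + 1) < a) (ha' : a < 1 / 2) {R : ℝ} (hR : 0 < R)
    (hRa : ((n : ℝ) - 1) / (1 / 2 - a) ≤ R) {k : ℝ} (hk : 0 ≤ k) (hk' : k ≤ (1 / 2 - a) / 2) :
    AntitoneOn (fun r => pohozaev p a u u' r + k * u r ^ 2) (Ici R) := by
  have hn' : (2 : ℝ) ≤ n := by exact_mod_cast hn
  have ha0 : 0 < a := lt_trans (by positivity) ha
  have hd : ∀ r, 0 < r → HasDerivAt (fun r => pohozaev p a u u' r + k * u r ^ 2) _ r :=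
    fun r hr => (hu.pohozaev_hasDerivAt hp a hr).add
      (((hu.hasDerivAt hr).pow 2).const_mul k)
  have hpos : ∀ r ∈ Ici R, 0 < r := fun r hr => hR.trans_le hr
  refine antitoneOn_of_hasDerivWithinAt_nonpos (convex_Ici R)
    (fun r hr => (hd r (hpos r hr)).continuousAt.continuousWithinAt)
    (fun r hr => (hd r (hpos r (interior_subset hr))).hasDerivWithinAt) ?_
  intro r hr
  have hRr : R ≤ r := interior_subset hr
  have hr0 : 0 < r := hR.trans_le hRr
  set δ := 1 / 2 - a with hδ
  have hδ0 : 0 < δ := by linarith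
  set q := a * ((n : ℝ) - 1) / r with hq
  have hq0 : 0 ≤ q := div_nonneg (mul_nonneg ha0.le (by linarith)) hr0.le
  have hqδ : q ≤ δ / 2 := by
    have h1 : (n : ℝ) - 1 ≤ r * δ := (div_le_iff₀ hδ0).1 (hRa.trans hRr)
    rw [hq, div_le_iff₀ hr0]
    nlinarith
  have hW : 0 ≤ (a - 1 / (p + 1)) * |u r| ^ (p + 1) :=
    mul_nonneg (by linarith) (by positivity)
  have hcoef : (a + 3 / 2 - n) * u' r ^ 2 ≤ -δ * u' r ^ 2 :=
    mul_le_mul_of_nonneg_right (by linarith) (sq_nonneg _)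
  have hcross : -(q * (u r * u' r)) ≤ δ / 2 * ((u r ^ 2 + u' r ^ 2) / 2) := by
    nlinarith [sq_nonneg (u r + u' r), mul_nonneg hq0 (sq_nonneg (u r + u' r)),
      mul_nonneg (sub_nonneg.2 hqδ) (add_nonneg (sq_nonneg (u r)) (sq_nonneg (u' r)))]
  have hcross' : k * (2 * (u r * u' r)) ≤ δ / 2 * (u r ^ 2 + u' r ^ 2) :=
    (mul_le_mul_of_nonneg_left (by nlinarith [sq_nonneg (u r - u' r)]) hk).trans
      (mul_le_mul_of_nonneg_right hk' (add_nonneg (sq_nonneg (u r)) (sq_nonneg (u' r))))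
  have hsum := mul_nonneg hδ0.le (add_nonneg (sq_nonneg (u r)) (sq_nonneg (u' r)))
  have hpow : ((2 : ℕ) : ℝ) * u r ^ (2 - 1) * u' r = 2 * (u r * u' r) := by
    norm_num
    ring
  rw [hpow]
  nlinarith

theorem finite_zeros_inter_Icc (hu : IsSolution n p α u u' u'') (hn : 1 ≤ n) (hp : 1 < p)
    (hα : α ≠ 0) (b : ℝ) : ({r : ℝ | 0 < r ∧ u r = 0} ∩ Icc 0 b).Finite := by
  by_contra hinf
  obtain ⟨x, hx, hacc⟩ := Set.Infinite.exists_accPt_of_subset_isCompact hinf isCompact_Icc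
    inter_subset_right
  have hfreq : ∃ᶠ y in nhdsWithin x {x}ᶜ, y ∈ {r : ℝ | 0 < r ∧ u r = 0} ∩ Icc 0 b :=
    accPt_iff_frequently_nhdsNE.1 hacc
  have hux : u x = 0 := by
    have hcl : IsClosed (Ici 0 ∩ u ⁻¹' {0}) :=
      hu.continuousOn.preimage_isClosed_of_isClosed isClosed_Ici isClosed_singleton
    have hmem : x ∈ closure (Ici 0 ∩ u ⁻¹' {0}) :=
      mem_closure_iff_frequently.2 ((hfreq.filter_mono nhdsWithin_le_nhds).mono
        fun y hy => ⟨hy.1.1.le, hy.1.2⟩)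
    exact (hcl.closure_subset hmem).2
  have hx0 : 0 < x := lt_of_le_of_ne hx.1 (by rintro rfl; exact hα (hu.init ▸ hux))
  refine hfreq ?_
  filter_upwards [(hu.hasDerivAt hx0).eventually_ne (c := 0)
    (hu.deriv_ne_zero_of_zero hn hp hα hx0 hux)] with y hy hy' using hy hy'.1.2

end IsSolution

/-- every solution of the IVP has at most finitely many zeros in `(0,∞)`. -/
theorem statement19 (n : ℕ) (hn : 3 ≤ n) (p : ℝ) (hp1 : 1 < p)
    (hp2 : p < ((n : ℝ) + 2) / ((n : ℝ) - 2))
    (α : ℝ) (hα : 0 < α)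
    (u u' u'' : ℝ → ℝ) (hu : IsSolution n p α u u' u'') :
    {r : ℝ | 0 < r ∧ u r = 0}.Finite := by
  have hn1 : 1 ≤ n := by omega
  obtain ⟨a, ha, ha'⟩ : ∃ a, 1 / (p + 1) < a ∧ a < 1 / 2 :=
    exists_between (one_div_lt_one_div_of_lt two_pos (by linarith))
  set δ := (1 / 2 - a) / 2 with hδ
  have hδ0 : 0 < δ := by linarith
  set R := max 1 (((n : ℝ) - 1) / (1 / 2 - a))
  have hR0 : 0 < R := lt_max_of_lt_left one_pos
  have hanti : ∀ k, 0 ≤ k → k ≤ δ →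
      AntitoneOn (fun r => pohozaev p a u u' r + k * u r ^ 2) (Ici R) :=
    fun k hk hk' => hu.pohozaev_add_sq_antitoneOn (by omega) hp1 ha ha' hR0 (le_max_right _ _) hk hk'
  have hstep : ∀ z y, R ≤ z → z < y → u z = 0 → u y = 0 →
      pohozaev p a u u' y ≤ pohozaev p a u u' z - δ := by
    intro z y hRz hzy huz huy
    obtain ⟨c, hc, -, hc1⟩ :=
      hu.exists_critical_point hn1 hp1 hα.ne' (hR0.trans_le hRz) hzy huz huy
    have hRc : R ≤ c := hRz.trans hc.1.le
    have h1 := hanti δ hδ0.le le_rfl hRz hRc hc.1.le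
    have h2 := hanti 0 le_rfl hδ0.le hRc (hRc.trans hc.2.le) hc.2.le
    simp only [huz] at h1
    simp only [zero_mul, add_zero] at h2
    nlinarith
  by_contra hinf
  have hnext : ∀ b, ∃ y, b < y ∧ 0 < y ∧ u y = 0 := by
    intro b
    by_contra! hb
    refine hinf ((hu.finite_zeros_inter_Icc hn1 hp1 hα.ne' b).subset fun y hy => ⟨hy, hy.1.le, ?_⟩)
    by_contra! hby
    exact hb y hby hy.1 hy.2
  obtain ⟨z₀, hRz₀, -, huz₀⟩ := hnext R
  have hdescent : ∀ k : ℕ, ∃ z, R ≤ z ∧ u z = 0 ∧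
      pohozaev p a u u' z ≤ pohozaev p a u u' z₀ - k * δ := by
    intro k
    induction k with
    | zero => exact ⟨z₀, hRz₀.le, huz₀, by simp⟩
    | succ k ih =>
      obtain ⟨z, hRz, huz, hP⟩ := ih
      obtain ⟨y, hzy, -, huy⟩ := hnext z
      refine ⟨y, hRz.trans hzy.le, huy, ?_⟩
      have := hstep z y hRz hzy huz huy
      push_cast
      linarith
  obtain ⟨k, hk⟩ := exists_nat_gt (pohozaev p a u u' z₀ / δ)
  obtain ⟨z, hRz, huz, hP⟩ := hdescent k
  have hk' := (div_lt_iff₀ hδ0).1 hk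
  have hnonneg : 0 ≤ pohozaev p a u u' z := by
    rw [pohozaev, IsSolution.energy_eq_of_zero hp1 huz, huz, zero_mul, mul_zero, add_zero]
    have := hR0.trans_le hRz
    positivity
  linarith
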